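/- There is an absolute constant c > 0 such that the following holds. Let n, m, t be positive integers and ε, δ ∈ (0, 1/3). Suppose D is a probability distribution over real m×n matrices with the property that for every choice of t vectors x₁, …, x_t ∈ R^n, with probability at least 1 − δ over Π drawn from D, the inequalities (1−ε)‖x_i‖₂ ≤ ‖Πx_i‖₂ ≤ (1+ε)‖x_i‖₂ hold simultaneously for all i ∈ [t]. Then m ≥ c · min{n, ε⁻² · log(t/δ)}. -/

import Mathlib

open MeasureTheory ProbabilityTheory

/-- The Euclidean (ℓ₂) norm of a vector in `Fin k → ℝ`. -/
noncomputable def l2norm {k : ℕ} (v : Fin k → ℝ) : ℝ := Real.sqrt (∑ i, (v i) ^ 2)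

instance matrixMeasurableSpace {m n : ℕ} : MeasurableSpace (Matrix (Fin m) (Fin n) ℝ) :=
  (inferInstance : MeasurableSpace (Fin m → Fin n → ℝ))

/-- `D` is an `(ε, δ)` oblivious subspace embedding distribution over real `m × n`
matrices for `d`-dimensional subspaces of `ℝⁿ`. -/
def IsOSE {m n : ℕ} (d : ℕ) (ε δ : ℝ) (D : Measure (Matrix (Fin m) (Fin n) ℝ)) : Prop :=
  ∀ W : Submodule ℝ (Fin n → ℝ), Module.finrank ℝ W = d →
    ENNReal.ofReal (1 - δ) ≤
      D {Φ | ∀ x ∈ W, (1 - ε) * l2norm x ≤ l2norm (Φ.mulVec x) ∧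
               l2norm (Φ.mulVec x) ≤ (1 + ε) * l2norm x}

open scoped ENNReal NNReal

section ProductDensity

variable {ι : Type*} [Fintype ι] {α : ι → Type*} [∀ i, MeasurableSpace (α i)]

lemma lintegral_pi_prod_eq_prod (μ : ∀ i, Measure (α i)) [∀ i, IsProbabilityMeasure (μ i)]
    {f : ∀ i, α i → ℝ≥0∞} (hf : ∀ i, Measurable (f i)) :
    ∫⁻ x, ∏ i, f i (x i) ∂(Measure.pi μ) = ∏ i, ∫⁻ y, f i y ∂(μ i) := by
  refine (lintegral_prod_eq_prod_lintegral_of_indepFun Finset.univ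
    (fun i (x : ∀ i, α i) ↦ f i (x i))
    (iIndepFun_pi fun i ↦ (hf i).aemeasurable)
    fun i ↦ (hf i).comp (measurable_pi_apply i)).trans ?_
  refine Finset.prod_congr rfl fun i _ ↦ ?_
  exact (measurePreserving_eval μ i).lintegral_comp (hf i)

lemma pi_withDensity_eq (μ : ∀ i, Measure (α i)) [∀ i, IsProbabilityMeasure (μ i)]
    {f : ∀ i, α i → ℝ≥0∞} (hf : ∀ i, Measurable (f i))
    [∀ i, IsProbabilityMeasure ((μ i).withDensity (f i))] :
    Measure.pi (fun i ↦ (μ i).withDensity (f i)) =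
      (Measure.pi μ).withDensity fun x ↦ ∏ i, f i (x i) := by
  classical
  refine Measure.pi_eq fun s hs ↦ ?_
  rw [withDensity_apply _ (MeasurableSet.univ_pi hs), ← lintegral_indicator (.univ_pi hs)]
  calc
    _ = ∫⁻ x, ∏ i, (s i).indicator (f i) (x i) ∂(Measure.pi μ) := by
      refine lintegral_congr fun x ↦ ?_
      by_cases hx : x ∈ Set.univ.pi s
      · rw [Set.indicator_of_mem hx]
        exact Finset.prod_congr rfl fun i _ ↦ (Set.indicator_of_mem (hx i (Set.mem_univ i)) _).symm
      · rw [Set.indicator_of_notMem hx]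
        obtain ⟨i, hi⟩ : ∃ i, x i ∉ s i := by simpa using hx
        exact (Finset.prod_eq_zero (Finset.mem_univ i) (Set.indicator_of_notMem hi _)).symm
    _ = ∏ i, (μ i).withDensity (f i) (s i) := by
      rw [lintegral_pi_prod_eq_prod μ fun i ↦ (hf i).indicator (hs i)]
      refine Finset.prod_congr rfl fun i _ ↦ ?_
      rw [lintegral_indicator (hs i), withDensity_apply _ (hs i)]

end ProductDensity

lemma sq_withDensity_apply_le {α : Type*} [MeasurableSpace α] (ν : Measure α) {f : α → ℝ≥0∞}
    (hf : Measurable f) {s : Set α} (hs : MeasurableSet s) :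
    (ν.withDensity f s) ^ 2 ≤ ν s * ∫⁻ x, f x ^ 2 ∂ν := by
  have h := ENNReal.lintegral_mul_le_Lp_mul_Lq ν (Real.HolderConjugate.two_two)
    (f := s.indicator 1) (g := f) ((measurable_one.indicator hs).aemeasurable) hf.aemeasurable
  have h1 : ∫⁻ x, (s.indicator (1 : α → ℝ≥0∞) * f) x ∂ν = ν.withDensity f s := by
    rw [withDensity_apply _ hs, ← lintegral_indicator hs]
    refine lintegral_congr fun x ↦ ?_
    by_cases hx : x ∈ s <;> simp [hx]
  have h2 : ∫⁻ x, s.indicator (1 : α → ℝ≥0∞) x ^ (2 : ℝ) ∂ν = ν s := by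
    rw [← lintegral_indicator_one hs]
    refine lintegral_congr fun x ↦ ?_
    by_cases hx : x ∈ s <;> simp [hx]
  rw [h1, h2] at h
  calc
    _ ≤ ((ν s) ^ (1 / 2 : ℝ) * (∫⁻ x, f x ^ (2 : ℝ) ∂ν) ^ (1 / 2 : ℝ)) ^ 2 := by gcongr
    _ = _ := by
      rw [mul_pow, ← ENNReal.rpow_mul_natCast, ← ENNReal.rpow_mul_natCast]
      norm_num

lemma gaussianReal_withDensity_exp_sq {v w : ℝ≥0} (hv : v ≠ 0) (c : ℝ) (hc : 0 < 1 - 2 * c * v)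
    (hw : (w : ℝ) = v / (1 - 2 * c * v)) :
    (gaussianReal 0 v).withDensity (fun x ↦ ENNReal.ofReal (Real.exp (c * x ^ 2))) =
      ENNReal.ofReal (√(1 - 2 * c * v))⁻¹ • gaussianReal 0 w := by
  have hv' : (0 : ℝ) < v := by positivity
  have hw' : (0 : ℝ) < w := by rw [hw]; positivity
  have hw0 : w ≠ 0 := by rintro rfl; simp at hw'
  rw [gaussianReal_of_var_ne_zero 0 hv, gaussianReal_of_var_ne_zero 0 hw0,
    ← withDensity_mul _ (measurable_gaussianPDF 0 v) (by fun_prop),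
    ← withDensity_smul _ (measurable_gaussianPDF 0 w)]
  congr 1
  ext x
  simp only [Pi.mul_apply, Pi.smul_apply, smul_eq_mul, gaussianPDF]
  rw [← ENNReal.ofReal_mul (gaussianPDFReal_nonneg _ _ _), ← ENNReal.ofReal_mul (by positivity)]
  congr 1
  simp only [gaussianPDFReal, sub_zero]
  have h1 : √(2 * Real.pi * v) = √(1 - 2 * c * v) * √(2 * Real.pi * w) := by
    rw [← Real.sqrt_mul hc.le, hw]
    congr 1
    rw [mul_left_comm, mul_div_cancel₀ _ hc.ne']
  have h2 : -x ^ 2 / (2 * v) + c * x ^ 2 = -x ^ 2 / (2 * w) := by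
    rw [hw]
    field_simp
    ring
  rw [mul_assoc, ← Real.exp_add, h2, h1, mul_inv, mul_assoc]

lemma lintegral_exp_sq_gaussianReal {v : ℝ≥0} (hv : v ≠ 0) (c : ℝ) (hc : 0 < 1 - 2 * c * v) :
    ∫⁻ x, ENNReal.ofReal (Real.exp (c * x ^ 2)) ∂(gaussianReal 0 v) =
      ENNReal.ofReal (√(1 - 2 * c * v))⁻¹ := by
  obtain ⟨w, hw⟩ : ∃ w : ℝ≥0, (w : ℝ) = v / (1 - 2 * c * v) :=
    ⟨⟨_, div_nonneg v.2 hc.le⟩, rfl⟩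
  rw [← setLIntegral_univ, ← withDensity_apply _ MeasurableSet.univ,
    gaussianReal_withDensity_exp_sq hv c hc hw]
  simp

/-- Scaling the coordinates in `S` by `√(1 - a)` distorts the standard Gaussian measure in a way
controlled by the `χ²`-divergence `(1 - a²)^(-|S|/2)`. -/
lemma sq_pi_gaussianReal_le_of_scaling {ι : Type*} [Fintype ι] [DecidableEq ι] (S : Finset ι)
    {a : ℝ} (ha0 : 0 ≤ a) (ha1 : a < 1) {G B : Set (ι → ℝ)} (hG : MeasurableSet G)
    (hB : MeasurableSet B) (hGB : ∀ x ∈ G, (fun i ↦ (if i ∈ S then √(1 - a) else 1) * x i) ∈ B) :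
    ((Measure.pi fun _ : ι ↦ gaussianReal 0 1) G) ^ 2 ≤
      (Measure.pi fun _ : ι ↦ gaussianReal 0 1) B *
        ENNReal.ofReal (√(1 - a ^ 2))⁻¹ ^ S.card := by
  have ha : 0 < 1 - a := by linarith
  obtain ⟨u, hu⟩ : ∃ u : ℝ≥0, (u : ℝ) = (1 - a)⁻¹ := ⟨⟨_, inv_nonneg.2 ha.le⟩, rfl⟩
  have hu0 : (0 : ℝ) < u := by rw [hu]; positivity
  set v : ι → ℝ≥0 := fun i ↦ if i ∈ S then u else 1 with hv
  set r : ι → ℝ := fun i ↦ if i ∈ S then √(1 - a) else 1 with hr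
  set c : ι → ℝ := fun i ↦ if i ∈ S then -a / 2 else 0 with hc
  have hv0 : ∀ i, v i ≠ 0 := fun i ↦ by
    simp only [hv]
    split_ifs
    · exact fun h ↦ hu0.ne' (by simp [h])
    · exact one_ne_zero
  have hcv : ∀ i, 1 - 2 * c i * v i = v i := fun i ↦ by
    simp only [hv, hc]
    split_ifs
    · rw [hu]; field_simp; ring
    · simp
  have hvpos : ∀ i, (0 : ℝ) < v i := fun i ↦ by have := hv0 i; positivity
  set f : ι → ℝ → ℝ≥0∞ := fun i x ↦ ENNReal.ofReal √(v i) * ENNReal.ofReal (Real.exp (c i * x ^ 2))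
    with hf
  have hfm : ∀ i, Measurable (f i) := fun i ↦ by fun_prop
  have hdens : ∀ i, (gaussianReal 0 (v i)).withDensity (f i) = gaussianReal 0 1 := fun i ↦ by
    have h := gaussianReal_withDensity_exp_sq (w := 1) (hv0 i) (c i) (by rw [hcv]; exact hvpos i)
      (by rw [hcv, div_self (hvpos i).ne']; rfl)
    rw [hcv] at h
    have hfi : f i = ENNReal.ofReal √(v i) • fun x : ℝ ↦ ENNReal.ofReal (Real.exp (c i * x ^ 2)) :=
      rfl
    rw [hfi, withDensity_smul _ (by fun_prop), h, smul_smul, ← ENNReal.ofReal_mul (by positivity),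
      mul_inv_cancel₀ (Real.sqrt_pos.2 (hvpos i)).ne', ENNReal.ofReal_one, one_smul]
  have hmap : (Measure.pi fun i ↦ gaussianReal 0 (v i)).map (fun x i ↦ r i * x i) =
      Measure.pi fun _ : ι ↦ gaussianReal 0 1 := by
    rw [Measure.pi_map_pi fun i ↦ by fun_prop]
    congr 1
    ext1 i
    rw [gaussianReal_map_const_mul, mul_zero]
    congr 1
    ext
    simp only [hr, hv]
    split_ifs
    · simp [hu, Real.sq_sqrt ha.le, ha.ne']
    · simp
  have hGB' : Measure.pi (fun i ↦ gaussianReal 0 (v i)) G ≤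
      (Measure.pi fun _ : ι ↦ gaussianReal 0 1) B := by
    rw [← hmap, Measure.map_apply (by fun_prop) hB]
    exact measure_mono hGB
  have hpi : (Measure.pi fun _ : ι ↦ gaussianReal 0 1) =
      (Measure.pi fun i ↦ gaussianReal 0 (v i)).withDensity fun x ↦ ∏ i, f i (x i) := by
    have : ∀ i, IsProbabilityMeasure ((gaussianReal 0 (v i)).withDensity (f i)) := fun i ↦ by
      rw [hdens]; infer_instance
    rw [← pi_withDensity_eq _ hfm]
    simp_rw [hdens]
  have hint : ∀ i, ∫⁻ y, f i y ^ 2 ∂(gaussianReal 0 (v i)) =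
      if i ∈ S then ENNReal.ofReal (√(1 - a ^ 2))⁻¹ else 1 := fun i ↦ by
    have hc2 : 1 - 2 * (2 * c i) * v i = 2 * v i - 1 := by linear_combination 2 * hcv i
    have hpos : 0 < 1 - 2 * (2 * c i) * v i := by
      rw [hc2]
      simp only [hv]
      split_ifs
      · have : 1 ≤ (1 - a)⁻¹ := (one_le_inv₀ ha).2 (by linarith)
        rw [hu]; linarith
      · norm_num
    have h := lintegral_exp_sq_gaussianReal (hv0 i) (2 * c i) hpos
    have hsq : ∀ y, f i y ^ 2 =
        ENNReal.ofReal (v i) * ENNReal.ofReal (Real.exp (2 * c i * y ^ 2)) := fun y ↦ by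
      simp only [hf]
      rw [mul_pow, ← ENNReal.ofReal_pow (by positivity), ← ENNReal.ofReal_pow (by positivity),
        Real.sq_sqrt (hvpos i).le, ← Real.exp_nat_mul]
      congr 3
      push_cast
      ring
    simp_rw [hsq]
    rw [lintegral_const_mul _ (by fun_prop), h, ← ENNReal.ofReal_mul (hvpos i).le, hc2]
    simp only [hv]
    split_ifs
    · congr 1
      rw [hu, ← mul_inv_rev, inv_inj]
      have : 2 * (1 - a)⁻¹ - 1 = (1 - a ^ 2) * ((1 - a)⁻¹) ^ 2 := by field_simp; ring
      rw [this, Real.sqrt_mul (by nlinarith), Real.sqrt_sq (by positivity), mul_assoc,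
        inv_mul_cancel₀ ha.ne', mul_one]
    · norm_num
  calc
    _ ≤ Measure.pi (fun i ↦ gaussianReal 0 (v i)) G *
        ∫⁻ x, (∏ i, f i (x i)) ^ 2 ∂(Measure.pi fun i ↦ gaussianReal 0 (v i)) := by
      rw [hpi]
      exact sq_withDensity_apply_le _ (by fun_prop) hG
    _ ≤ _ := by
      simp_rw [← Finset.prod_pow]
      rw [lintegral_pi_prod_eq_prod _ fun i ↦ (hfm i).pow_const 2]
      simp_rw [hint]
      rw [Finset.prod_ite_mem, Finset.univ_inter, Finset.prod_const]
      gcongr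

/-- The Gaussian mass of the coordinates in `S` rarely dominates that of its large complement. -/
lemma pi_gaussianReal_sum_sq_le {ι : Type*} [Fintype ι] [DecidableEq ι] (S : Finset ι)
    (hS : S.Nonempty) (hcard : 106 * S.card ≤ Sᶜ.card) :
    (Measure.pi fun _ : ι ↦ gaussianReal 0 1) {x | ∑ i ∈ Sᶜ, x i ^ 2 ≤ 5 * ∑ i ∈ S, x i ^ 2} ≤
      ENNReal.ofReal (1 / 100) := by
  set c : ι → ℝ := fun i ↦ if i ∈ S then 1 / 4 else -1 / 20 with hc
  set f : ι → ℝ → ℝ≥0∞ := fun i x ↦ ENNReal.ofReal (Real.exp (c i * x ^ 2)) with hf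
  have hfm : ∀ i, Measurable (f i) := fun i ↦ by fun_prop
  have hpos : ∀ i, 0 < 1 - 2 * c i * (1 : ℝ≥0) := fun i ↦ by
    simp only [hc]; split_ifs <;> norm_num
  have hsum : ∀ x : ι → ℝ, ∑ i, c i * x i ^ 2 =
      1 / 20 * (5 * ∑ i ∈ S, x i ^ 2 - ∑ i ∈ Sᶜ, x i ^ 2) := fun x ↦ by
    rw [← Finset.sum_add_sum_compl S, mul_sub, Finset.mul_sum, Finset.mul_sum, Finset.mul_sum,
      sub_eq_add_neg, ← Finset.sum_neg_distrib]
    congr 1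
    · refine Finset.sum_congr rfl fun i hi ↦ ?_
      simp only [hc, hi, if_true]; ring
    · refine Finset.sum_congr rfl fun i hi ↦ ?_
      simp only [hc, Finset.mem_compl.1 hi, if_false]; ring
  have hexp : ∀ x : ι → ℝ, ∏ i, f i (x i) =
      ENNReal.ofReal (Real.exp (1 / 20 * (5 * ∑ i ∈ S, x i ^ 2 - ∑ i ∈ Sᶜ, x i ^ 2))) := fun x ↦ by
    rw [← hsum, Real.exp_sum, ENNReal.ofReal_prod_of_nonneg fun i _ ↦ (Real.exp_pos _).le]
  have hbase : (√2 * (√(11 / 10))⁻¹ ^ 106 : ℝ) ≤ 1 / 100 := by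
    have h1 : (√2 : ℝ) ≤ 3 / 2 := by rw [Real.sqrt_le_left (by norm_num)]; norm_num
    have h2 : (√(11 / 10))⁻¹ ^ 106 = ((11 / 10 : ℝ)⁻¹) ^ 53 := by
      rw [← Real.sqrt_inv, show 106 = 2 * 53 from rfl, pow_mul, Real.sq_sqrt (by norm_num)]
    rw [h2]
    calc _ ≤ 3 / 2 * ((11 / 10 : ℝ)⁻¹) ^ 53 := by gcongr
      _ ≤ _ := by norm_num
  calc
    _ ≤ (Measure.pi fun _ : ι ↦ gaussianReal 0 1) {x | 1 ≤ ∏ i, f i (x i)} := by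
      refine measure_mono fun x hx ↦ ?_
      rw [Set.mem_ofPred_eq] at hx ⊢
      rw [hexp, ← ENNReal.ofReal_one]
      refine ENNReal.ofReal_le_ofReal (Real.one_le_exp ?_)
      linarith
    _ ≤ ∫⁻ x, ∏ i, f i (x i) ∂(Measure.pi fun _ : ι ↦ gaussianReal 0 1) := by
      simpa using mul_meas_ge_le_lintegral
        (μ := Measure.pi fun _ : ι ↦ gaussianReal 0 1) (f := fun x ↦ ∏ i, f i (x i)) (by fun_prop) 1
    _ = ∏ i, ENNReal.ofReal (√(1 - 2 * c i * (1 : ℝ≥0)))⁻¹ := by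
      rw [lintegral_pi_prod_eq_prod _ hfm]
      exact Finset.prod_congr rfl fun i _ ↦
        lintegral_exp_sq_gaussianReal one_ne_zero (c i) (hpos i)
    _ = ENNReal.ofReal (√2 ^ S.card * (√(11 / 10))⁻¹ ^ Sᶜ.card) := by
      rw [← ENNReal.ofReal_prod_of_nonneg fun i _ ↦ by positivity, ← Finset.prod_mul_prod_compl S,
        Finset.prod_congr rfl fun i hi ↦ show (√(1 - 2 * c i * (1 : ℝ≥0)))⁻¹ = √2 by
          simp only [hc, hi, if_true]; rw [← Real.sqrt_inv]; norm_num,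
        Finset.prod_congr rfl fun i hi ↦ show (√(1 - 2 * c i * (1 : ℝ≥0)))⁻¹ = (√(11 / 10))⁻¹ by
          simp only [hc, Finset.mem_compl.1 hi, if_false]; norm_num,
        Finset.prod_const, Finset.prod_const]
    _ ≤ _ := by
      refine ENNReal.ofReal_le_ofReal ?_
      have h1 : (√(11 / 10))⁻¹ ≤ (1 : ℝ) :=
        inv_le_one_of_one_le₀ (Real.one_le_sqrt.2 (by norm_num))
      calc
        _ ≤ √2 ^ S.card * (√(11 / 10))⁻¹ ^ (106 * S.card) := by
          gcongr √2 ^ S.card * ?_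
          exact pow_le_pow_of_le_one (by positivity) h1 hcard
        _ = (√2 * (√(11 / 10))⁻¹ ^ 106) ^ S.card := by rw [mul_pow, ← pow_mul]
        _ ≤ (√2 * (√(11 / 10))⁻¹ ^ 106) ^ 1 :=
          pow_le_pow_of_le_one (by positivity) (hbase.trans (by norm_num)) hS.card_pos
        _ ≤ 1 / 100 := by rwa [pow_one]

lemma l2norm_ofLp {k : ℕ} (x : EuclideanSpace ℝ (Fin k)) : l2norm x.ofLp = ‖x‖ := by
  simp [l2norm, EuclideanSpace.norm_eq]

lemma exists_orthonormalBasis_mulVec_eq_zero {m n : ℕ} (Φ : Matrix (Fin m) (Fin n) ℝ) :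
    ∃ b : OrthonormalBasis (Fin n) ℝ (EuclideanSpace ℝ (Fin n)),
      ∀ i : Fin n, m ≤ i → Φ.mulVec (b i).ofLp = 0 := by
  set L : EuclideanSpace ℝ (Fin n) →ₗ[ℝ] (Fin m → ℝ) :=
    Φ.mulVecLin ∘ₗ (WithLp.linearEquiv 2 ℝ (Fin n → ℝ)).toLinearMap with hL
  have hK : n - m ≤ Module.finrank ℝ (LinearMap.ker L) := by
    have h1 := L.finrank_range_add_finrank_ker
    have h2 : Module.finrank ℝ (LinearMap.range L) ≤ m := by
      simpa using Submodule.finrank_le (LinearMap.range L)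
    rw [finrank_euclideanSpace_fin] at h1
    omega
  set e := stdOrthonormalBasis ℝ (LinearMap.ker L)
  set w : Fin n → EuclideanSpace ℝ (Fin n) := fun i ↦
    if h : m ≤ i then e ⟨i - m, by omega⟩ else 0 with hw
  have horth : Orthonormal ℝ ({i : Fin n | m ≤ i}.domRestrict w) := by
    have h := (e.orthonormal.comp (fun i : {i : Fin n | m ≤ i} ↦
      (⟨i - m, by have := i.2; simp only [Set.mem_ofPred_eq] at this; omega⟩ : Fin _))
      fun i j hij ↦ by
        have hi := i.2
        have hj := j.2
        simp only [Set.mem_ofPred_eq, Fin.mk.injEq] at hi hj hij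
        exact Subtype.ext (Fin.ext (by omega))).comp_linearIsometry
          (LinearMap.ker L).subtypeₗᵢ
    convert! h using 1
    ext1 i
    have := i.2
    simp only [Set.mem_ofPred_eq] at this
    simp [hw, this]
  obtain ⟨b, hb⟩ := horth.exists_orthonormalBasis_extension_of_card_eq (by simp)
  refine ⟨b, fun i hi ↦ ?_⟩
  have hbi : b i ∈ LinearMap.ker L := by
    rw [hb i hi]
    simp [hw, hi]
  exact hbi

lemma pi_gaussianReal_map_orthonormalBasis {n : ℕ}
    (b : OrthonormalBasis (Fin n) ℝ (EuclideanSpace ℝ (Fin n))) :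
    (Measure.pi fun _ : Fin n ↦ gaussianReal 0 1).map (fun y ↦ (∑ i, y i • b i).ofLp) =
      Measure.pi fun _ : Fin n ↦ gaussianReal 0 1 := by
  have h := (stdGaussian_eq_map_pi_orthonormalBasis b).symm.trans
    (map_pi_eq_stdGaussian (ι := Fin n)).symm
  have h2 := congrArg (Measure.map (WithLp.ofLp (p := 2) (V := Fin n → ℝ))) h
  rw [Measure.map_map (by fun_prop) (by fun_prop),
    Measure.map_map (by fun_prop) (by fun_prop)] at h2
  refine h2.trans ?_
  exact Measure.map_id

/-- Shrinking the first part of a vector that is nearly preserved in norm spoils the preservation,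
if the first part is relatively short. -/
lemma not_le_of_shrink {ε a u v A : ℝ} (hε0 : 0 < ε) (hε1 : ε < 1 / 3)
    (ha : a = 6 / 5 * (4 * ε / (1 + ε) ^ 2)) (hu : 0 ≤ u) (huv : 5 * u < v)
    (hA : A ≤ (1 + ε) ^ 2 * (u + v)) : (1 - a) * A < (1 - ε) ^ 2 * ((1 - a) * u + v) := by
  have h1 : 0 < (1 + ε) ^ 2 := by positivity
  have haε : a * (1 + ε) ^ 2 = 24 / 5 * ε := by rw [ha]; field_simp; ring
  have ha1 : a < 1 := by
    by_contra! h
    nlinarith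
  have ha0 : 0 ≤ a := by rw [ha]; positivity
  calc
    _ ≤ (1 - a) * ((1 + ε) ^ 2 * (u + v)) := by gcongr
    _ < _ := by
      have key : (1 - ε) ^ 2 * ((1 - a) * u + v) - (1 - a) * ((1 + ε) ^ 2 * (u + v)) =
          4 * ε * (v / 5 - u) + 4 * ε * a * u := by
        linear_combination (u + v - u) * haε
      have : 0 < 4 * ε * (v / 5 - u) := by apply mul_pos <;> linarith
      have : 0 ≤ 4 * ε * a * u := by positivity
      linarith

/-- The vectors whose norm is preserved by `Φ` up to a factor `1 ± ε`. -/
def wellPreserved {m n : ℕ} (ε : ℝ) (Φ : Matrix (Fin m) (Fin n) ℝ) : Set (Fin n → ℝ) :=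
  {x | (1 - ε) * l2norm x ≤ l2norm (Φ.mulVec x) ∧ l2norm (Φ.mulVec x) ≤ (1 + ε) * l2norm x}

lemma sq_l2norm_smul {k : ℕ} (r : ℝ) (z : Fin k → ℝ) :
    l2norm (r • z) ^ 2 = r ^ 2 * l2norm z ^ 2 := by
  unfold l2norm
  rw [Real.sq_sqrt (by positivity), Real.sq_sqrt (by positivity), Finset.mul_sum]
  simp [mul_pow]

lemma measurable_l2norm {k : ℕ} : Measurable (l2norm : (Fin k → ℝ) → ℝ) := by
  unfold l2norm
  fun_prop

lemma measurableSet_wellPreserved {m n : ℕ} (ε : ℝ) (Φ : Matrix (Fin m) (Fin n) ℝ) :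
    MeasurableSet (wellPreserved ε Φ) := by
  have h : Measurable fun x : Fin n → ℝ ↦ l2norm (Φ.mulVec x) :=
    measurable_l2norm.comp (Continuous.measurable (by fun_prop))
  exact (measurableSet_le (measurable_l2norm.const_mul _) h).inter
    (measurableSet_le h (measurable_l2norm.const_mul _))

lemma sq_gaussian_wellPreserved_le {m n : ℕ} (hm : 0 < m) (hmn : 107 * m ≤ n) {ε : ℝ}
    (hε0 : 0 < ε) (hε1 : ε < 1 / 3) (Φ : Matrix (Fin m) (Fin n) ℝ) {a : ℝ}
    (ha : a = 6 / 5 * (4 * ε / (1 + ε) ^ 2)) :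
    ((Measure.pi fun _ : Fin n ↦ gaussianReal 0 1) (wellPreserved ε Φ) -
        ENNReal.ofReal (1 / 100)) ^ 2 ≤
      (1 - (Measure.pi fun _ : Fin n ↦ gaussianReal 0 1) (wellPreserved ε Φ)) *
        ENNReal.ofReal (√(1 - a ^ 2))⁻¹ ^ m := by
  have haε : a * (1 + ε) ^ 2 = 24 / 5 * ε := by rw [ha]; field_simp; ring
  have ha1 : a < 1 := by
    by_contra! h
    nlinarith
  have ha0 : 0 ≤ a := by rw [ha]; positivity
  obtain ⟨b, hb⟩ := exists_orthonormalBasis_mulVec_eq_zero Φ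
  set γ : Measure (Fin n → ℝ) := Measure.pi fun _ : Fin n ↦ gaussianReal 0 1 with hγ
  set F : (Fin n → ℝ) → Fin n → ℝ := fun y ↦ (∑ i, y i • b i).ofLp with hF
  have hFm : Measurable F := by fun_prop
  have hmap : γ.map F = γ := pi_gaussianReal_map_orthonormalBasis b
  set G := wellPreserved ε Φ with hG
  have hGm : MeasurableSet G := measurableSet_wellPreserved ε Φ
  set S : Finset (Fin n) := {i | (i : ℕ) < m} with hS
  have hScard : S.card = m := by
    rw [hS, Fin.card_filter_val_lt, min_eq_right (by omega)]
  have hnorm : ∀ y, l2norm (F y) ^ 2 = ∑ i ∈ S, y i ^ 2 + ∑ i ∈ Sᶜ, y i ^ 2 := fun y ↦ by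
    rw [Finset.sum_add_sum_compl, l2norm_ofLp, ← b.sum_sq_norm_inner_right]
    refine Finset.sum_congr rfl fun i _ ↦ ?_
    rw [b.orthonormal.inner_right_fintype]
    simp
  set r : ℝ := √(1 - a) with hr
  have hr2 : r ^ 2 = 1 - a := Real.sq_sqrt (by linarith)
  have hmul : ∀ y, Φ.mulVec (F fun i ↦ (if i ∈ S then r else 1) * y i) = r • Φ.mulVec (F y) :=
    fun y ↦ by
      have hexp : ∀ z : Fin n → ℝ, Φ.mulVec (F z) = ∑ i, z i • Φ.mulVec (b i).ofLp := fun z ↦ by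
        simp only [hF, WithLp.ofLp_sum, WithLp.ofLp_smul]
        rw [Matrix.mulVec_sum]
        simp_rw [Matrix.mulVec_smul]
      rw [hexp, hexp, Finset.smul_sum]
      refine Finset.sum_congr rfl fun i _ ↦ ?_
      by_cases hi : i ∈ S
      · simp [hi, mul_smul]
      · rw [hb i (by simpa [hS] using hi)]
        simp
  have hl2 : ∀ {k : ℕ} (z : Fin k → ℝ), 0 ≤ l2norm z := fun z ↦ Real.sqrt_nonneg _
  set W : Set (Fin n → ℝ) := {y | ∑ i ∈ Sᶜ, y i ^ 2 ≤ 5 * ∑ i ∈ S, y i ^ 2} with hW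
  have hWm : MeasurableSet W := measurableSet_le (by fun_prop) (by fun_prop)
  have hWle : γ W ≤ ENNReal.ofReal (1 / 100) := by
    refine pi_gaussianReal_sum_sq_le S (Finset.card_pos.1 (by omega)) ?_
    rw [Finset.card_compl, hScard, Fintype.card_fin]
    omega
  have hscale := sq_pi_gaussianReal_le_of_scaling S ha0 ha1
    (G := F ⁻¹' G \ W) (B := F ⁻¹' Gᶜ) ((hFm hGm).diff hWm) (hFm hGm.compl) ?_
  · rw [hScard, ← hγ] at hscale
    have h1 : γ (F ⁻¹' G) = γ G := by rw [← Measure.map_apply hFm hGm, hmap]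
    have h2 : γ (F ⁻¹' Gᶜ) = 1 - γ G := by
      rw [← Measure.map_apply hFm hGm.compl, hmap, prob_compl_eq_one_sub hGm]
    rw [h2] at hscale
    refine le_trans ?_ hscale
    gcongr
    rw [← h1]
    exact (tsub_le_tsub_left hWle _).trans le_measure_sdiff
  · rintro y ⟨⟨-, hy⟩, hyW⟩ ⟨hlow, -⟩
    simp only [hW, Set.mem_ofPred_eq, not_le] at hyW
    have hlow2 := pow_le_pow_left₀ (mul_nonneg (by linarith) (hl2 _)) hlow 2
    have hy2 := pow_le_pow_left₀ (hl2 _) hy 2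
    rw [hmul, sq_l2norm_smul, mul_pow, hnorm, hr2] at hlow2
    rw [mul_pow, hnorm] at hy2
    have hs1 : ∑ i ∈ S, ((if i ∈ S then r else 1) * y i) ^ 2 = (1 - a) * ∑ i ∈ S, y i ^ 2 := by
      rw [Finset.mul_sum, ← hr2]
      exact Finset.sum_congr rfl fun i hi ↦ by simp [hi, mul_pow]
    have hs2 : ∑ i ∈ Sᶜ, ((if i ∈ S then r else 1) * y i) ^ 2 = ∑ i ∈ Sᶜ, y i ^ 2 :=
      Finset.sum_congr rfl fun i hi ↦ by simp [Finset.mem_compl.1 hi]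
    rw [hs1, hs2] at hlow2
    exact (not_le_of_shrink hε0 hε1 ha (Finset.sum_nonneg fun i _ ↦ sq_nonneg _) hyW hy2).not_ge
      hlow2

lemma exists_pow_wellPreserved_ge {m n t : ℕ} {ε δ : ℝ} (D : Measure (Matrix (Fin m) (Fin n) ℝ))
    [IsProbabilityMeasure D] (γ : Measure (Fin n → ℝ)) [IsProbabilityMeasure γ]
    (h : ∀ x : Fin t → Fin n → ℝ,
      ENNReal.ofReal (1 - δ) ≤ D {Φ | ∀ i, x i ∈ wellPreserved ε Φ}) :
    ∃ Φ : Matrix (Fin m) (Fin n) ℝ, ENNReal.ofReal (1 - δ) ≤ γ (wellPreserved ε Φ) ^ t := by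
  set E : Set ((Fin t → Fin n → ℝ) × Matrix (Fin m) (Fin n) ℝ) :=
    {p | ∀ i, p.1 i ∈ wellPreserved ε p.2} with hE
  have hEm : MeasurableSet E := by
    have hcoord : ∀ k l, Measurable fun Φ : Matrix (Fin m) (Fin n) ℝ ↦ Φ k l := fun k l ↦
      (measurable_pi_apply l).comp (measurable_pi_apply (X := fun _ : Fin m ↦ Fin n → ℝ) k)
    have hx : ∀ i, Measurable fun p : (Fin t → Fin n → ℝ) × Matrix (Fin m) (Fin n) ℝ ↦
        l2norm (p.1 i) := fun i ↦ measurable_l2norm.comp (by fun_prop)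
    have hΦx : ∀ i, Measurable fun p : (Fin t → Fin n → ℝ) × Matrix (Fin m) (Fin n) ℝ ↦
        l2norm (p.2.mulVec (p.1 i)) := fun i ↦ by
      refine measurable_l2norm.comp (measurable_pi_lambda _ fun k ↦ ?_)
      simp only [Matrix.mulVec, dotProduct]
      refine Finset.measurable_sum (M := ℝ) _ fun l _ ↦ ?_
      exact ((hcoord k l).comp measurable_snd).mul (by fun_prop)
    have hEeq : E = ⋂ i, {p | (1 - ε) * l2norm (p.1 i) ≤ l2norm (p.2.mulVec (p.1 i))} ∩
        {p | l2norm (p.2.mulVec (p.1 i)) ≤ (1 + ε) * l2norm (p.1 i)} := by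
      ext p
      simp [hE, wellPreserved]
    rw [hEeq]
    exact MeasurableSet.iInter fun i ↦ (measurableSet_le ((hx i).const_mul _) (hΦx i)).inter
      (measurableSet_le (hΦx i) ((hx i).const_mul _))
  have hfub : ∫⁻ Φ, γ (wellPreserved ε Φ) ^ t ∂D =
      ∫⁻ x, D {Φ | ∀ i, x i ∈ wellPreserved ε Φ} ∂(Measure.pi fun _ : Fin t ↦ γ) := by
    calc
      _ = ∫⁻ Φ, (Measure.pi fun _ : Fin t ↦ γ) ((fun x ↦ (x, Φ)) ⁻¹' E) ∂D := by
        refine lintegral_congr fun Φ ↦ ?_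
        have : (fun x ↦ (x, Φ)) ⁻¹' E = Set.univ.pi fun _ : Fin t ↦ wellPreserved ε Φ := by
          ext x
          simp [hE]
        rw [this, Measure.pi_pi, Finset.prod_const, Finset.card_univ, Fintype.card_fin]
      _ = ((Measure.pi fun _ : Fin t ↦ γ).prod D) E := (Measure.prod_apply_symm hEm).symm
      _ = _ := Measure.prod_apply hEm
  have hle : ENNReal.ofReal (1 - δ) ≤ ∫⁻ Φ, γ (wellPreserved ε Φ) ^ t ∂D := by
    rw [hfub]
    calc
      _ = ∫⁻ _, ENNReal.ofReal (1 - δ) ∂(Measure.pi fun _ : Fin t ↦ γ) := by simp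
      _ ≤ _ := lintegral_mono h
  have hfin : ∫⁻ Φ, γ (wellPreserved ε Φ) ^ t ∂D ≠ ⊤ := by
    refine ne_top_of_le_ne_top ENNReal.one_ne_top ?_
    calc
      _ ≤ ∫⁻ _, 1 ∂D := lintegral_mono fun Φ ↦ pow_le_one₀ (zero_le) prob_le_one
      _ = 1 := by simp
  obtain ⟨Φ, hΦ⟩ := exists_lintegral_le hfin
  exact ⟨Φ, hle.trans hΦ⟩

lemma exp_neg_le_one_sub {δ : ℝ} (h0 : 0 < δ) (h1 : δ < 1 / 3) :
    Real.exp (-(127 / 100 * δ)) ≤ 1 - δ := by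
  have h := Real.quadratic_le_exp_of_nonneg (x := 127 / 100 * δ) (by positivity)
  rw [Real.exp_neg]
  refine inv_le_of_inv_le₀ (by linarith) (le_trans ?_ h)
  rw [inv_le_iff_one_le_mul₀ (by linarith)]
  have : 0 ≤ δ * (1 / 3 - δ) := mul_nonneg h0.le (by linarith)
  have : 0 ≤ δ * (δ * (1 / 3 - δ)) := mul_nonneg h0.le this
  nlinarith

lemma mul_one_sub_le_of_one_sub_le_pow {t : ℕ} {δ g : ℝ} (hδ0 : 0 < δ) (hδ1 : δ < 1 / 3)
    (hg0 : 0 ≤ g) (h : 1 - δ ≤ g ^ t) : t * (1 - g) ≤ 127 / 100 * δ := by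
  have h1 : g ≤ Real.exp (-(1 - g)) := by linarith [Real.add_one_le_exp (-(1 - g))]
  have h2 : Real.exp (-(127 / 100 * δ)) ≤ Real.exp (t * -(1 - g)) := by
    rw [Real.exp_nat_mul]
    exact (exp_neg_le_one_sub hδ0 hδ1).trans (h.trans (pow_le_pow_left₀ hg0 h1 t))
  linarith [Real.exp_le_exp.1 h2]

lemma log_inv_sqrt_one_sub_sq_le {ε a : ℝ} (hε0 : 0 < ε) (hε1 : ε < 1 / 3)
    (ha : a = 6 / 5 * (4 * ε / (1 + ε) ^ 2)) :
    Real.log (√(1 - a ^ 2))⁻¹ ≤ 61 * ε ^ 2 := by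
  have haε : a * (1 + ε) ^ 2 = 24 / 5 * ε := by rw [ha]; field_simp; ring
  have ha0 : 0 ≤ a := by rw [ha]; positivity
  have ha1 : a ≤ 9 / 10 := by
    rw [ha, ← mul_div_assoc, div_le_iff₀ (by positivity)]
    nlinarith
  have ha2 : a ≤ 24 / 5 * ε := haε ▸ le_mul_of_one_le_right ha0 (by nlinarith)
  have ha3 : a ^ 2 ≤ (24 / 5 * ε) ^ 2 := pow_le_pow_left₀ ha0 ha2 2
  have hpos : 19 / 100 ≤ 1 - a ^ 2 := by nlinarith
  have hlog := Real.one_sub_inv_le_log_of_pos (x := 1 - a ^ 2) (by linarith)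
  have hinv : (1 - a ^ 2)⁻¹ - 1 ≤ 122 * ε ^ 2 := by
    have : (1 - a ^ 2)⁻¹ - 1 = a ^ 2 / (1 - a ^ 2) := by
      rw [eq_div_iff (by linarith), sub_mul, inv_mul_cancel₀ (by linarith)]
      ring
    rw [this, div_le_iff₀ (by linarith)]
    nlinarith [sq_nonneg ε]
  rw [Real.log_inv, Real.log_sqrt (by linarith)]
  linarith

lemma log_div_le_of_wellPreserved {m n t : ℕ} {ε δ : ℝ} (hm : 0 < m) (hmn : 107 * m ≤ n)
    (ht : 0 < t) (hε0 : 0 < ε) (hε1 : ε < 1 / 3) (hδ0 : 0 < δ) (hδ1 : δ < 1 / 3)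
    (Φ : Matrix (Fin m) (Fin n) ℝ)
    (hΦ : ENNReal.ofReal (1 - δ) ≤
      (Measure.pi fun _ : Fin n ↦ gaussianReal 0 1) (wellPreserved ε Φ) ^ t) :
    Real.log (t / δ) ≤ Real.log (59 / 20) + 61 * (m * ε ^ 2) := by
  set a := 6 / 5 * (4 * ε / (1 + ε) ^ 2) with ha
  set γ : Measure (Fin n → ℝ) := Measure.pi fun _ : Fin n ↦ gaussianReal 0 1
  set g : ℝ := γ.real (wellPreserved ε Φ) with hg
  have hg0 : 0 ≤ g := measureReal_nonneg
  have hg1 : g ≤ 1 := measureReal_le_one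
  have hγg : γ (wellPreserved ε Φ) = ENNReal.ofReal g := by rw [hg, ofReal_measureReal]
  rw [hγg, ← ENNReal.ofReal_pow hg0, ENNReal.ofReal_le_ofReal_iff (by positivity)] at hΦ
  have hp := mul_one_sub_le_of_one_sub_le_pow hδ0 hδ1 hg0 hΦ
  have hg23 : 2 / 3 < g := by linarith [pow_le_of_le_one hg0 hg1 ht.ne']
  set q : ℝ := (√(1 - a ^ 2))⁻¹ with hq
  have hsq := sq_gaussian_wellPreserved_le hm hmn hε0 hε1 Φ ha
  have hq0 : 0 ≤ q := by positivity
  rw [hγg, ← ENNReal.ofReal_sub _ (by norm_num), ← ENNReal.ofReal_one,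
    ← ENNReal.ofReal_sub _ hg0, ← ENNReal.ofReal_pow hq0, ← ENNReal.ofReal_pow (by linarith),
    ← ENNReal.ofReal_mul (by linarith),
    ENNReal.ofReal_le_ofReal_iff (mul_nonneg (by linarith) (by positivity))] at hsq
  have hsq' : (197 / 300) ^ 2 ≤ (1 - g) * q ^ m :=
    (pow_le_pow_left₀ (by norm_num) (by linarith) 2).trans hsq
  have hqm : 0 < q ^ m := by
    refine (by positivity : 0 ≤ q ^ m).lt_of_ne fun h ↦ ?_
    rw [← h] at hsq'
    norm_num at hsq'
  have hqpos : 0 < q := hq0.lt_of_ne fun h ↦ by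
    rw [← h, zero_pow hm.ne'] at hqm
    exact hqm.false
  have htpos : (0 : ℝ) < t := by positivity
  have hX : t / δ ≤ 59 / 20 * q ^ m := by
    rw [div_le_iff₀ hδ0]
    have h1 : t * ((197 / 300) ^ 2) ≤ 127 / 100 * δ * q ^ m := by
      calc _ ≤ t * ((1 - g) * q ^ m) := by gcongr
        _ = t * (1 - g) * q ^ m := by ring
        _ ≤ _ := by gcongr
    nlinarith [mul_pos hδ0 hqm]
  calc
    _ ≤ Real.log (59 / 20 * q ^ m) := Real.log_le_log (by positivity) hX
    _ = Real.log (59 / 20) + m * Real.log q := by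
      rw [Real.log_mul (by norm_num) hqm.ne', Real.log_pow]
    _ ≤ Real.log (59 / 20) + m * (61 * ε ^ 2) := by
      gcongr
      exact log_inv_sqrt_one_sub_sq_le hε0 hε1 ha
    _ = _ := by ring

theorem stmt2 :
    ∃ c : ℝ, 0 < c ∧
      ∀ (n m t : ℕ) (ε δ : ℝ) (D : Measure (Matrix (Fin m) (Fin n) ℝ)),
        IsProbabilityMeasure D →
        0 < n → 0 < m → 0 < t →
        ε ∈ Set.Ioo (0:ℝ) (1/3) → δ ∈ Set.Ioo (0:ℝ) (1/3) →
        (∀ x : Fin t → Fin n → ℝ,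
          ENNReal.ofReal (1 - δ) ≤
            D {Φ | ∀ i, (1 - ε) * l2norm (x i) ≤ l2norm (Φ.mulVec (x i)) ∧
                     l2norm (Φ.mulVec (x i)) ≤ (1 + ε) * l2norm (x i)}) →
        c * min (n : ℝ) ((ε ^ 2)⁻¹ * Real.log ((t : ℝ) / δ)) ≤ (m : ℝ) := by
  have hlog3 : 0 < Real.log 3 := Real.log_pos (by norm_num)
  have hlogK : Real.log (59 / 20) < Real.log 3 := Real.log_lt_log (by norm_num) (by norm_num)
  set κ := 1 - Real.log (59 / 20) / Real.log 3 with hκ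
  have hκ0 : 0 < κ := sub_pos.2 ((div_lt_one hlog3).2 hlogK)
  refine ⟨min (1 / 107) (κ / 61), by positivity, ?_⟩
  intro n m t ε δ D hD hn hm ht hε hδ h
  obtain ⟨hε0, hε1⟩ := hε
  obtain ⟨hδ0, hδ1⟩ := hδ
  have hX : 3 ≤ t / δ := by
    rw [le_div_iff₀ hδ0]
    have : (1 : ℝ) ≤ t := by exact_mod_cast ht
    linarith
  have hlogX : Real.log 3 ≤ Real.log (t / δ) := Real.log_le_log (by norm_num) hX
  have hmin : 0 ≤ min (n : ℝ) ((ε ^ 2)⁻¹ * Real.log ((t : ℝ) / δ)) :=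
    le_min n.cast_nonneg (mul_nonneg (by positivity) (hlog3.le.trans hlogX))
  rcases lt_or_ge n (107 * m) with hmn | hmn
  · have : (n : ℝ) ≤ 107 * m := by exact_mod_cast hmn.le
    calc
      _ ≤ 1 / 107 * (n : ℝ) :=
        mul_le_mul (min_le_left _ _) (min_le_left _ _) hmin (by norm_num)
      _ ≤ m := by linarith
  · obtain ⟨Φ, hΦ⟩ := exists_pow_wellPreserved_ge D (Measure.pi fun _ : Fin n ↦ gaussianReal 0 1) h
    have hlog := log_div_le_of_wellPreserved hm hmn ht hε0 hε1 hδ0 hδ1 Φ hΦ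
    have hκX : κ * Real.log (t / δ) ≤ 61 * (m * ε ^ 2) := by
      have h1 : Real.log (59 / 20) ≤ Real.log (59 / 20) / Real.log 3 * Real.log (t / δ) := by
        rw [div_mul_eq_mul_div, le_div_iff₀ hlog3]
        exact mul_le_mul_of_nonneg_left hlogX (Real.log_nonneg (by norm_num))
      rw [hκ, sub_mul, one_mul]
      linarith
    calc
      _ ≤ κ / 61 * ((ε ^ 2)⁻¹ * Real.log (t / δ)) :=
        mul_le_mul (min_le_right _ _) (min_le_right _ _) hmin (by positivity)
      _ = κ * Real.log (t / δ) / 61 / ε ^ 2 := by ring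
      _ ≤ m := by
        rw [div_le_iff₀ (by positivity)]
        linarith
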